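/- Let P ∈ ℂ[x] be a univariate complex polynomial such that ∫_ℝ P(x)ᵐ dγ₁(x) = 0 for all integers m ≥ 1, where γ₁ is the standard normal distribution N(0,1) on ℝ. Then P = 0. -/

import Mathlib

open MeasureTheory ProbabilityTheory

/-- The moments of the standard normal distribution. -/
def gaussianMoment : ℕ → ℕ
  | 0 => 1
  | 1 => 0
  | n + 2 => (n + 1) * gaussianMoment n

lemma gaussianMoment_eq_zero_of_odd {n : ℕ} (hn : Odd n) : gaussianMoment n = 0 := by
  induction n using Nat.strong_induction_on with
  | _ n ih =>
    match n with
    | 0 => simp at hn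
    | 1 => rfl
    | m + 2 =>
      have hm : Odd m := by grind
      simp [gaussianMoment, ih m (by lia) hm]

lemma Nat.Prime.dvd_gaussianMoment {p n : ℕ} (hp : p.Prime) (hp2 : p ≠ 2) (hn : p ≤ n) :
    p ∣ gaussianMoment n := by
  induction n using Nat.strong_induction_on with
  | _ n ih =>
    have hodd : Odd p := hp.odd_of_ne_two hp2
    have := hp.two_le
    obtain ⟨m, rfl⟩ : ∃ m, n = m + 2 := ⟨n - 2, by lia⟩
    rw [gaussianMoment]
    by_cases hpm : p ≤ m
    · exact (ih m (by lia) hpm).mul_left _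
    · obtain h | h : p = m + 1 ∨ p = m + 2 := by lia
      · exact h ▸ dvd_mul_right _ _
      · have hm : Odd m := by grind
        simp [gaussianMoment_eq_zero_of_odd hm]

lemma Nat.Prime.not_dvd_gaussianMoment {p n : ℕ} (hp : p.Prime) (hn : n < p) (heven : Even n) :
    ¬ p ∣ gaussianMoment n := by
  induction n using Nat.strong_induction_on with
  | _ n ih =>
    match n with
    | 0 => simpa [gaussianMoment] using hp.ne_one
    | 1 => simp at heven
    | m + 2 =>
      have hm : Even m := by grind
      rw [gaussianMoment, hp.dvd_mul, not_or]
      exact ⟨Nat.not_dvd_of_pos_of_lt (by lia) (by lia), ih m (by lia) (by lia) hm⟩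

lemma integrable_pow_mul_gaussianPDFReal (n : ℕ) :
    Integrable fun x : ℝ ↦ x ^ n * gaussianPDFReal 0 1 x := by
  have h := integrable_rpow_mul_exp_neg_mul_sq (b := 1 / 2) (by norm_num) (s := n)
    (by linarith [n.cast_nonneg (α := ℝ)])
  refine (h.const_mul (√(2 * Real.pi))⁻¹).congr (ae_of_all _ fun x ↦ ?_)
  simp only [gaussianPDFReal, Real.rpow_natCast, sub_zero, NNReal.coe_one, mul_one]
  ring_nf

lemma hasDerivAt_neg_gaussianPDFReal (x : ℝ) :
    HasDerivAt (fun x ↦ -gaussianPDFReal 0 1 x) (x * gaussianPDFReal 0 1 x) x := by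
  have h : HasDerivAt (fun y : ℝ ↦ -y ^ 2 / 2) (-x) x :=
    ((hasDerivAt_pow 2 x).fun_neg.div_const 2).congr_deriv (by simp; ring)
  have heq : (fun x ↦ -gaussianPDFReal 0 1 x) =
      fun y ↦ -(√(2 * Real.pi))⁻¹ * Real.exp (-y ^ 2 / 2) := by
    ext y
    simp [gaussianPDFReal]
  rw [heq]
  refine (h.exp.const_mul _).congr_deriv ?_
  simp only [gaussianPDFReal, sub_zero, NNReal.coe_one, mul_one]
  ring

lemma integral_pow_mul_gaussianPDFReal (n : ℕ) :
    ∫ x : ℝ, x ^ n * gaussianPDFReal 0 1 x = gaussianMoment n := by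
  have key (n : ℕ) : ∫ x : ℝ, x ^ (n + 1) * gaussianPDFReal 0 1 x =
      n * ∫ x : ℝ, x ^ (n - 1) * gaussianPDFReal 0 1 x := by
    have h := integral_mul_deriv_eq_deriv_mul_of_integrable
      (u := fun x : ℝ ↦ x ^ n) (u' := fun x ↦ n * x ^ (n - 1))
      (v := fun x ↦ -gaussianPDFReal 0 1 x) (v' := fun x ↦ x * gaussianPDFReal 0 1 x)
      (fun x _ ↦ hasDerivAt_pow n x) (fun x _ ↦ hasDerivAt_neg_gaussianPDFReal x)
      ((integrable_pow_mul_gaussianPDFReal (n + 1)).congr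
        (ae_of_all _ fun x ↦ by simp [pow_succ, mul_assoc]))
      (((integrable_pow_mul_gaussianPDFReal (n - 1)).const_mul (-n : ℝ)).congr
        (ae_of_all _ fun x ↦ by simp [mul_assoc]))
      ((integrable_pow_mul_gaussianPDFReal n).neg.congr (ae_of_all _ fun x ↦ by simp))
    simpa [pow_succ, mul_assoc, integral_neg, integral_const_mul] using h
  induction n using gaussianMoment.induct with
  | case1 => simp [gaussianMoment, integral_gaussianPDFReal_eq_one]
  | case2 => simpa [gaussianMoment] using key 0
  | case3 n ih => rw [key (n + 1), Nat.add_sub_cancel, ih, gaussianMoment]; push_cast; rfl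

lemma integral_ofReal_pow_gaussianReal (n : ℕ) :
    ∫ x : ℝ, (x : ℂ) ^ n ∂gaussianReal 0 1 = gaussianMoment n := by
  have h : ∫ x : ℝ, x ^ n ∂gaussianReal 0 1 = gaussianMoment n := by
    rw [integral_gaussianReal_eq_integral_smul one_ne_zero, ← integral_pow_mul_gaussianPDFReal]
    simp_rw [smul_eq_mul, mul_comm]
  simp_rw [← Complex.ofReal_pow]
  rw [integral_complex_ofReal, h, Complex.ofReal_natCast]

lemma integrable_ofReal_pow_gaussianReal (n : ℕ) :
    Integrable (fun x : ℝ ↦ (x : ℂ) ^ n) (gaussianReal 0 1) := by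
  have h := (memLp_id_gaussianReal (μ := 0) (v := 1) n).integrable_norm_pow'
  refine h.mono' (by fun_prop) (ae_of_all _ fun x ↦ by simp)

namespace Polynomial

variable {R S : Type*} [CommRing R] [CommRing S]

/-- The formal Gaussian expectation of a polynomial. -/
def gaussianExpectation (f : R[X]) : R :=
  f.sum fun n a ↦ a * gaussianMoment n

lemma gaussianExpectation_add (f g : R[X]) :
    gaussianExpectation (f + g) = gaussianExpectation f + gaussianExpectation g :=
  sum_add_index _ _ _ (by simp) (by simp [add_mul])

lemma gaussianExpectation_monomial (n : ℕ) (a : R) :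
    gaussianExpectation (monomial n a) = a * gaussianMoment n :=
  sum_monomial_index _ _ (by simp)

lemma gaussianExpectation_map (φ : R →+* S) (f : R[X]) :
    gaussianExpectation (f.map φ) = φ (gaussianExpectation f) := by
  induction f using Polynomial.induction_on' with
  | add f g hf hg => simp [gaussianExpectation_add, hf, hg]
  | monomial n a => simp [gaussianExpectation_monomial]

lemma integrable_eval_ofReal_gaussianReal (f : ℂ[X]) :
    Integrable (fun x : ℝ ↦ f.eval (x : ℂ)) (gaussianReal 0 1) := by
  induction f using Polynomial.induction_on' with
  | add f g hf hg => simpa only [eval_add] using hf.fun_add hg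
  | monomial n a => simpa using (integrable_ofReal_pow_gaussianReal n).const_mul a

lemma integral_eval_ofReal_gaussianReal (f : ℂ[X]) :
    ∫ x : ℝ, f.eval (x : ℂ) ∂gaussianReal 0 1 = gaussianExpectation f := by
  induction f using Polynomial.induction_on' with
  | add f g hf hg =>
    simp only [eval_add, gaussianExpectation_add, ← hf, ← hg]
    exact integral_add (integrable_eval_ofReal_gaussianReal f)
      (integrable_eval_ofReal_gaussianReal g)
  | monomial n a =>
    simp [gaussianExpectation_monomial, integral_const_mul, integral_ofReal_pow_gaussianReal]

/-- In odd characteristic `p`, only the coefficients of degree less than `p` contribute to the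
Gaussian expectation. -/
lemma gaussianExpectation_eq_coeff_mul (p : ℕ) [CharP R p] (hp : p.Prime) (hp2 : p ≠ 2)
    (f : R[X]) (n : ℕ) (hf : ∀ i < p, i ≠ n → f.coeff i = 0) :
    gaussianExpectation f = f.coeff n * gaussianMoment n := by
  refine Finset.sum_eq_single n (fun i _ hi ↦ ?_) (by simp +contextual)
  obtain h | h := lt_or_ge i p
  · simp [hf i h hi]
  · simp [(CharP.cast_eq_zero_iff R p _).2 (hp.dvd_gaussianMoment hp2 h)]

lemma exists_gaussianExpectation_pow_ne_zero [IsDomain R] (p : ℕ) [CharP R p] (hp : p.Prime)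
    (hp2 : p ≠ 2) (f : R[X]) (k : ℕ) (hk : k ≠ 0 → p ≡ 1 [MOD k])
    (hf : ∀ i < k, f.coeff i = 0) (hfk : f.coeff k ≠ 0) :
    ∃ m, 1 ≤ m ∧ gaussianExpectation (f ^ m) ≠ 0 := by
  have hne {n : ℕ} (hn : n < p) (heven : Even n) : (gaussianMoment n : R) ≠ 0 :=
    fun h ↦ hp.not_dvd_gaussianMoment hn heven ((CharP.cast_eq_zero_iff R p _).1 h)
  have := Fact.mk hp
  obtain rfl | hk0 := eq_or_ne k 0
  · refine ⟨p, hp.one_le, ?_⟩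
    have hexp : f ^ p = expand R p (f.map (frobenius R p)) := by
      rw [← map_expand, map_frobenius_expand]
    rw [gaussianExpectation_eq_coeff_mul p hp hp2 _ 0]
    · rw [coeff_zero_eq_eval_zero, eval_pow, ← coeff_zero_eq_eval_zero]
      exact mul_ne_zero (pow_ne_zero _ hfk) (hne hp.pos (by simp))
    · intro i hi hi0
      rw [hexp, coeff_expand hp.pos, if_neg (Nat.not_dvd_of_pos_of_lt (by lia) hi)]
  · obtain ⟨m, hm⟩ := (Nat.modEq_iff_dvd' hp.one_le).1 (hk hk0).symm
    obtain ⟨g, rfl⟩ := X_pow_dvd_iff.2 hf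
    have hp1 := hp.one_lt
    have hm0 : m ≠ 0 := by rintro rfl; lia
    refine ⟨m, by lia, ?_⟩
    rw [mul_pow, ← pow_mul, ← hm, gaussianExpectation_eq_coeff_mul p hp hp2 _ (p - 1)]
    · refine mul_ne_zero ?_ (hne (by lia) (hp.even_sub_one hp2))
      rw [coeff_X_pow_mul', if_pos le_rfl] at hfk ⊢
      rw [Nat.sub_self] at hfk ⊢
      rw [coeff_zero_eq_eval_zero, eval_pow, ← coeff_zero_eq_eval_zero]
      exact pow_ne_zero _ hfk
    · intro i hi hi'
      rw [coeff_X_pow_mul', if_neg (by lia)]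

end Polynomial

/-- A nonzero element of a finitely generated domain of characteristic zero remains nonzero modulo
some prime ideal above `p`, for every large prime number `p`. -/
lemma exists_isPrime_natCast_mem_notMem {R : Type*} [CommRing R] [IsDomain R] [CharZero R]
    [Algebra.FiniteType ℤ R] {a : R} (ha : a ≠ 0) :
    ∃ N : ℕ, ∀ p : ℕ, p.Prime → N < p → ∃ I : Ideal R, I.IsPrime ∧ (p : R) ∈ I ∧ a ∉ I := by
  have : Algebra.FinitePresentation ℤ R := Algebra.FinitePresentation.of_finiteType.1 inferInstance
  have hopen := PrimeSpectrum.isOpenMap_comap_of_hasGoingDown_of_finitePresentation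
    (R := ℤ) (S := R) _ (PrimeSpectrum.basicOpen a).isOpen
  have hbot : (⊥ : PrimeSpectrum ℤ) ∈
      PrimeSpectrum.comap (algebraMap ℤ R) '' (PrimeSpectrum.basicOpen a) := by
    refine ⟨⊥, by simpa [PrimeSpectrum.mem_basicOpen] using ha, ?_⟩
    ext x
    simp
  obtain ⟨_, ⟨n, rfl⟩, hn, hsub⟩ :=
    PrimeSpectrum.isTopologicalBasis_basic_opens.exists_subset_of_mem_open hbot hopen
  have hn0 : n ≠ 0 := by simpa [PrimeSpectrum.mem_basicOpen] using hn
  refine ⟨n.natAbs, fun p hp hNp ↦ ?_⟩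
  have hprime : (Ideal.span {(p : ℤ)}).IsPrime :=
    (Ideal.span_singleton_prime (by exact_mod_cast hp.ne_zero)).2 (Nat.prime_iff_prime_int.1 hp)
  have hmem : (⟨_, hprime⟩ : PrimeSpectrum ℤ) ∈ PrimeSpectrum.basicOpen n := by
    rw [PrimeSpectrum.mem_basicOpen, Ideal.mem_span_singleton, Int.natCast_dvd]
    exact Nat.not_dvd_of_pos_of_lt (Int.natAbs_pos.2 hn0) hNp
  obtain ⟨q, hq, hqp⟩ := hsub hmem
  refine ⟨q.asIdeal, q.isPrime, ?_, hq⟩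
  have : (p : ℤ) ∈ (PrimeSpectrum.comap (algebraMap ℤ R) q).asIdeal := by
    rw [hqp]
    exact Ideal.mem_span_singleton_self _
  simpa using this

lemma Polynomial.eq_zero_of_gaussianExpectation_pow_eq_zero {R : Type*} [CommRing R] [IsDomain R]
    [CharZero R] [Algebra.FiniteType ℤ R] (f : Polynomial R)
    (h : ∀ m, 1 ≤ m → gaussianExpectation (f ^ m) = 0) : f = 0 := by
  by_contra hf
  obtain ⟨N, hN⟩ := exists_isPrime_natCast_mem_notMem
    (a := f.coeff f.natTrailingDegree) (by simpa [← trailingCoeff.eq_1] using hf)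
  set k := f.natTrailingDegree
  obtain ⟨p, hp, hNp, hpk⟩ :
      ∃ p : ℕ, p.Prime ∧ N + 2 < p ∧ (k ≠ 0 → p ≡ 1 [MOD k]) := by
    by_cases hk : k = 0
    · obtain ⟨p, hle, hp⟩ := Nat.exists_infinite_primes (N + 3)
      exact ⟨p, hp, hle, fun h ↦ (h hk).elim⟩
    · obtain ⟨p, hp, hlt, hmod⟩ := Nat.exists_prime_gt_modEq_one (N + 2) hk
      exact ⟨p, hp, hlt, fun _ ↦ hmod⟩
  obtain ⟨I, hI, hpI, haI⟩ := hN p hp (by lia)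
  have : CharP (R ⧸ I) p := by
    rw [CharP.charP_iff_prime_eq_zero hp]
    simpa using Ideal.Quotient.eq_zero_iff_mem.2 hpI
  obtain ⟨m, hm, hne⟩ := exists_gaussianExpectation_pow_ne_zero p hp (by lia)
    (f.map (Ideal.Quotient.mk I)) k hpk
    (fun i hi ↦ by rw [coeff_map, coeff_eq_zero_of_lt_natTrailingDegree hi, map_zero])
    (by rwa [coeff_map, Ne, Ideal.Quotient.eq_zero_iff_mem])
  rw [← Polynomial.map_pow, gaussianExpectation_map, h m hm, map_zero] at hne
  exact hne rfl

/-- a univariate complex polynomial all of whose Gaussian moments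
`E(P(X)^m)`, `m ≥ 1`, vanish is the zero polynomial. -/
theorem univariate_gaussian_moments (P : Polynomial ℂ)
    (h : ∀ m : ℕ, 1 ≤ m →
      (∫ x : ℝ, (Polynomial.eval (x : ℂ) P) ^ m ∂(gaussianReal 0 1)) = 0) :
    P = 0 := by
  let A := Algebra.adjoin ℤ (P.coeffs : Set ℂ)
  have : Algebra.FiniteType ℤ A := A.fg_iff_finiteType.1 (Subalgebra.fg_adjoin_finset _)
  obtain ⟨Q, hQP⟩ : P ∈ Polynomial.lifts (algebraMap A ℂ) := by
    rw [Polynomial.lifts_iff_coeff_lifts]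
    intro n
    by_cases hn : P.coeff n = 0
    · exact ⟨0, by simp [hn]⟩
    · exact ⟨⟨P.coeff n, Algebra.subset_adjoin (Polynomial.coeff_mem_coeffs hn)⟩, rfl⟩
  suffices hQ : Q = 0 by simp [← hQP, hQ]
  refine Q.eq_zero_of_gaussianExpectation_pow_eq_zero fun m hm ↦ ?_
  have hm' := h m hm
  simp_rw [← Polynomial.eval_pow, Polynomial.integral_eval_ofReal_gaussianReal] at hm'
  rw [← hQP, Polynomial.coe_mapRingHom, ← Polynomial.map_pow, Polynomial.gaussianExpectation_map] at hm'
  exact FaithfulSMul.algebraMap_injective A ℂ (by simpa using hm')
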